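/- Let S be a (2,ω)-divisible Cu-semigroup satisfying (O5), (O6) and (O7), and let ι: S_soft → S be the inclusion of the sub-Cu-semigroup of strongly soft elements. Then the restriction map ι*: F(S) → F(S_soft), given by ι*(λ) := λ∘ι, is a bijection between the set of functionals on S and the set of functionals on S_soft. -/

import Mathlib

open Set

/-- The way-below relation: `x ≪ y` if for every increasing sequence with a
supremum dominating `y`, some term of the sequence dominates `x`. -/
def WayBelow {S : Type*} [Preorder S] (x y : S) : Prop :=
  ∀ z : ℕ → S, Monotone z → ∀ s : S, IsLUB (Set.range z) s → y ≤ s → ∃ m : ℕ, x ≤ z m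

/-- A Cu-semigroup: a positively ordered commutative monoid satisfying (O1)-(O4). -/
class CuSemigroup (S : Type*) extends AddCommMonoid S, PartialOrder S where
  zero_le : ∀ x : S, 0 ≤ x
  add_mono : ∀ {a b c d : S}, a ≤ b → c ≤ d → a + c ≤ b + d
  O1 : ∀ z : ℕ → S, Monotone z → ∃ s : S, IsLUB (Set.range z) s
  O2 : ∀ x : S, ∃ z : ℕ → S, (∀ n, WayBelow (z n) (z (n + 1))) ∧ IsLUB (Set.range z) x
  O3 : ∀ {x' x y' y : S}, WayBelow x' x → WayBelow y' y → WayBelow (x' + y') (x + y)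
  O4 : ∀ (x y : ℕ → S), Monotone x → Monotone y → ∀ sx sy : S,
      IsLUB (Set.range x) sx → IsLUB (Set.range y) sy →
      IsLUB (Set.range fun n => x n + y n) (sx + sy)

variable {S : Type*}

lemma CuSemigroup.nsmul_mono [CuSemigroup S] (x : S) : Monotone fun n : ℕ => n • x := by
  intro n m h
  obtain ⟨k, rfl⟩ := Nat.exists_eq_add_of_le h
  show n • x ≤ (n + k) • x
  rw [add_nsmul]
  calc n • x = n • x + 0 := by rw [add_zero]
    _ ≤ n • x + k • x := CuSemigroup.add_mono le_rfl (CuSemigroup.zero_le _)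

/-- `infty x` is the supremum of the increasing sequence `n • x`, i.e. `∞x`. -/
noncomputable def infty [CuSemigroup S] (x : S) : S :=
  (CuSemigroup.O1 (fun n : ℕ => n • x) (CuSemigroup.nsmul_mono x)).choose

lemma infty_isLUB [CuSemigroup S] (x : S) :
    IsLUB (Set.range fun n : ℕ => n • x) (infty x) :=
  (CuSemigroup.O1 (fun n : ℕ => n • x) (CuSemigroup.nsmul_mono x)).choose_spec

/-- An element is strongly soft if every `x' ≪ x` admits `t` with `x' + t ≪ x`
and `x' ≪ ∞t`. -/
def StronglySoft [CuSemigroup S] (x : S) : Prop :=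
  ∀ x' : S, WayBelow x' x → ∃ t : S, WayBelow (x' + t) x ∧ WayBelow x' (infty t)

def SatisfiesO5 (S : Type*) [CuSemigroup S] : Prop :=
  ∀ x' x y' y z : S, WayBelow x' x → WayBelow y' y → x + y ≤ z →
    ∃ c : S, WayBelow y' c ∧ x' + c ≤ z ∧ z ≤ x + c

def SatisfiesO6 (S : Type*) [CuSemigroup S] : Prop :=
  ∀ x' x y z : S, WayBelow x' x → WayBelow x (y + z) →
    ∃ v w : S, v ≤ x ∧ v ≤ y ∧ w ≤ x ∧ w ≤ z ∧ x' ≤ v + w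

def SatisfiesO7 (S : Type*) [CuSemigroup S] : Prop :=
  ∀ x' x y' y w : S, WayBelow x' x → x ≤ w → WayBelow y' y → y ≤ w →
    ∃ z : S, WayBelow x' z ∧ WayBelow y' z ∧ z ≤ w ∧ z ≤ x + y

def TwoOmegaDivisible (S : Type*) [CuSemigroup S] : Prop :=
  ∀ x' x : S, WayBelow x' x → ∃ y : S, 2 • y ≤ x ∧ x' ≤ infty y

def WeaklyCancellative (S : Type*) [CuSemigroup S] : Prop :=
  ∀ x y z : S, WayBelow (x + z) (y + z) → WayBelow x y

def Separative (S : Type*) [CuSemigroup S] : Prop :=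
  ∀ x y t : S, WayBelow (x + t) (y + t) → WayBelow t (infty x) → WayBelow t (infty y) →
    WayBelow x y

def LeftSoftSeparative (S : Type*) [CuSemigroup S] : Prop :=
  ∀ x y t : S, StronglySoft x → WayBelow (x + t) (y + t) → WayBelow t (infty x) →
    WayBelow t (infty y) → WayBelow x y

def AlmostUnperforated (S : Type*) [CuSemigroup S] : Prop :=
  ∀ x y : S, (∃ n : ℕ, 1 ≤ n ∧ (n + 1) • x ≤ n • y) → x ≤ y

def CountablyBased (S : Type*) [CuSemigroup S] : Prop :=
  ∃ D : Set S, D.Countable ∧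
    ∀ x : S, ∃ z : ℕ → S, Monotone z ∧ (∀ n, z n ∈ D) ∧ IsLUB (Set.range z) x

/-- `Lset x` is the set `L_x = { u' : u' ≪ u ≪ x for some strongly soft u }`. -/
def Lset [CuSemigroup S] (x : S) : Set S :=
  { u' | ∃ u : S, StronglySoft u ∧ WayBelow u' u ∧ WayBelow u x }

/-- A functional on a Cu-semigroup: a monoid morphism to `[0,∞]` preserving order
and suprema of increasing sequences. -/
structure CuFunctional (S : Type*) [CuSemigroup S] where
  toFun : S → ENNReal
  map_zero : toFun 0 = 0
  map_add : ∀ x y : S, toFun (x + y) = toFun x + toFun y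
  mono : ∀ x y : S, x ≤ y → toFun x ≤ toFun y
  map_sup : ∀ z : ℕ → S, Monotone z → ∀ s : S, IsLUB (Set.range z) s →
    toFun s = ⨆ n, toFun (z n)

/-- Predicate version: `f : S → [0,∞]` is a functional on `S`. -/
def IsCuFunctional [CuSemigroup S] (f : S → ENNReal) : Prop :=
  f 0 = 0 ∧ (∀ x y : S, f (x + y) = f x + f y) ∧ (∀ x y : S, x ≤ y → f x ≤ f y) ∧
  (∀ z : ℕ → S, Monotone z → ∀ s : S, IsLUB (Set.range z) s → f s = ⨆ n, f (z n))

/-- Least upper bound of `A` computed within the subset `T`. -/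
def IsLUBIn [CuSemigroup S] (T : Set S) (A : Set S) (s : S) : Prop :=
  s ∈ T ∧ s ∈ upperBounds A ∧ ∀ b ∈ T, b ∈ upperBounds A → s ≤ b

/-- The way-below relation computed within the subset `T`. -/
def WayBelowIn [CuSemigroup S] (T : Set S) (x y : S) : Prop :=
  ∀ z : ℕ → S, Monotone z → (∀ n, z n ∈ T) → ∀ s : S, IsLUBIn T (Set.range z) s → y ≤ s →
    ∃ m : ℕ, x ≤ z m

/-- `T` is a sub-Cu-semigroup of `S`: a submonoid which is itself a Cu-semigroup
for the inherited order, such that the inclusion preserves suprema of increasing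
sequences and the way-below relation. -/
structure IsSubCuSemigroup [CuSemigroup S] (T : Set S) : Prop where
  zero_mem : (0 : S) ∈ T
  add_mem : ∀ {x y : S}, x ∈ T → y ∈ T → x + y ∈ T
  o1 : ∀ z : ℕ → S, Monotone z → (∀ n, z n ∈ T) → ∃ s : S, IsLUBIn T (Set.range z) s
  o2 : ∀ x ∈ T, ∃ z : ℕ → S, (∀ n, z n ∈ T) ∧ (∀ n, WayBelowIn T (z n) (z (n + 1))) ∧
        IsLUBIn T (Set.range z) x
  o3 : ∀ {x' x y' y : S}, x' ∈ T → x ∈ T → y' ∈ T → y ∈ T →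
        WayBelowIn T x' x → WayBelowIn T y' y → WayBelowIn T (x' + y') (x + y)
  o4 : ∀ (x y : ℕ → S), Monotone x → Monotone y → (∀ n, x n ∈ T) → (∀ n, y n ∈ T) →
        ∀ sx sy : S, IsLUBIn T (Set.range x) sx → IsLUBIn T (Set.range y) sy →
        IsLUBIn T (Set.range fun n => x n + y n) (sx + sy)
  incl_sup : ∀ z : ℕ → S, Monotone z → (∀ n, z n ∈ T) → ∀ s : S,
        IsLUBIn T (Set.range z) s → IsLUB (Set.range z) s
  incl_wayBelow : ∀ {x y : S}, x ∈ T → y ∈ T → WayBelowIn T x y → WayBelow x y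

def SatisfiesO5In [CuSemigroup S] (T : Set S) : Prop :=
  ∀ x' x y' y z : S, x' ∈ T → x ∈ T → y' ∈ T → y ∈ T → z ∈ T →
    WayBelowIn T x' x → WayBelowIn T y' y → x + y ≤ z →
    ∃ c ∈ T, WayBelowIn T y' c ∧ x' + c ≤ z ∧ z ≤ x + c

def SatisfiesO6In [CuSemigroup S] (T : Set S) : Prop :=
  ∀ x' x y z : S, x' ∈ T → x ∈ T → y ∈ T → z ∈ T →
    WayBelowIn T x' x → WayBelowIn T x (y + z) →
    ∃ v ∈ T, ∃ w ∈ T, v ≤ x ∧ v ≤ y ∧ w ≤ x ∧ w ≤ z ∧ x' ≤ v + w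

def SatisfiesO7In [CuSemigroup S] (T : Set S) : Prop :=
  ∀ x' x y' y w : S, x' ∈ T → x ∈ T → y' ∈ T → y ∈ T → w ∈ T →
    WayBelowIn T x' x → x ≤ w → WayBelowIn T y' y → y ≤ w →
    ∃ z ∈ T, WayBelowIn T x' z ∧ WayBelowIn T y' z ∧ z ≤ w ∧ z ≤ x + y

/-- `f` is a functional on the sub-Cu-semigroup `T` (values off `T` are irrelevant). -/
def IsFunctionalOn [CuSemigroup S] (T : Set S) (f : S → ENNReal) : Prop :=
  f 0 = 0 ∧
  (∀ x ∈ T, ∀ y ∈ T, f (x + y) = f x + f y) ∧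
  (∀ x ∈ T, ∀ y ∈ T, x ≤ y → f x ≤ f y) ∧
  (∀ z : ℕ → S, Monotone z → (∀ n, z n ∈ T) → ∀ s : S, IsLUBIn T (Set.range z) s →
    f s = ⨆ n, f (z n))

/-- An element is full if `x ≤ ∞e` for every `x`. -/
def IsFull [CuSemigroup S] (e : S) : Prop := ∀ x : S, x ≤ infty e

/-- Condition (R1) for `r`: comparison of `x` with `y` whenever
`λ(x) + r·λ(e) ≤ λ(y)` for all functionals. -/
def SatisfiesR1 (S : Type*) [CuSemigroup S] (e : S) (r : NNReal) : Prop :=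
  ∀ x y : S,
    (∀ lam : CuFunctional S, lam.toFun x + (r : ENNReal) * lam.toFun e ≤ lam.toFun y) → x ≤ y

/-- The radius of comparison of `(S, e)`. -/
noncomputable def rc (S : Type*) [CuSemigroup S] (e : S) : ENNReal :=
  ⨅ r ∈ {r : NNReal | 0 < r ∧ SatisfiesR1 S e r}, (r : ENNReal)

/-- Condition (R1) for the sub-Cu-semigroup `T`. -/
def SatisfiesR1On [CuSemigroup S] (T : Set S) (e : S) (r : NNReal) : Prop :=
  ∀ x ∈ T, ∀ y ∈ T,
    (∀ f : S → ENNReal, IsFunctionalOn T f → f x + (r : ENNReal) * f e ≤ f y) → x ≤ y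

/-- The radius of comparison of `(T, e)` for a sub-Cu-semigroup `T ⊆ S`. -/
noncomputable def rcOn [CuSemigroup S] (T : Set S) (e : S) : ENNReal :=
  ⨅ r ∈ {r : NNReal | 0 < r ∧ SatisfiesR1On T e r}, (r : ENNReal)

/-- `dim S ≤ n` in the sense of covering dimension of Cu-semigroups. -/
def DimLe (S : Type*) [CuSemigroup S] (n : ℕ) : Prop :=
  ∀ (x' x : S) (r : ℕ) (y : Fin r → S), WayBelow x' x → WayBelow x (∑ j, y j) →
    ∃ z : Fin r → Fin (n + 1) → S,
      (∀ j k, WayBelow (z j k) (y j)) ∧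
      WayBelow x' (∑ j, ∑ k, z j k) ∧
      (∀ k, WayBelow (∑ j, z j k) x)

/-- The covering dimension of a Cu-semigroup, in `ℕ ∪ {∞}`. -/
noncomputable def cuDim (S : Type*) [CuSemigroup S] : ℕ∞ :=
  ⨅ n ∈ {n : ℕ | DimLe S n}, (n : ℕ∞)

/-- `dim T ≤ n` for a sub-Cu-semigroup `T ⊆ S`. -/
def DimLeOn [CuSemigroup S] (T : Set S) (n : ℕ) : Prop :=
  ∀ (x' x : S), x' ∈ T → x ∈ T → ∀ (r : ℕ) (y : Fin r → S), (∀ j, y j ∈ T) →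
    WayBelowIn T x' x → WayBelowIn T x (∑ j, y j) →
    ∃ z : Fin r → Fin (n + 1) → S,
      (∀ j k, z j k ∈ T) ∧
      (∀ j k, WayBelowIn T (z j k) (y j)) ∧
      WayBelowIn T x' (∑ j, ∑ k, z j k) ∧
      (∀ k, WayBelowIn T (∑ j, z j k) x)

/-- The covering dimension of a sub-Cu-semigroup `T ⊆ S`. -/
noncomputable def cuDimOn [CuSemigroup S] (T : Set S) : ℕ∞ :=
  ⨅ n ∈ {n : ℕ | DimLeOn T n}, (n : ℕ∞)

instance CuSemigroup.isOrderedAddMonoid [CuSemigroup S] : IsOrderedAddMonoid S where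
  add_le_add_left _ _ h _ := CuSemigroup.add_mono h le_rfl

section WayBelow

lemma WayBelow.le [Preorder S] {x y : S} (h : WayBelow x y) : x ≤ y := by
  obtain ⟨_, hm⟩ := h (fun _ => y) monotone_const y (by simp) le_rfl
  exact hm

lemma WayBelow.trans_le [Preorder S] {x y z : S} (h : WayBelow x y) (h' : y ≤ z) :
    WayBelow x z :=
  fun w hw s hs hzs => h w hw s hs (h'.trans hzs)

lemma WayBelow.le_trans [Preorder S] {x y z : S} (h : x ≤ y) (h' : WayBelow y z) :
    WayBelow x z := fun w hw s hs hzs =>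
  let ⟨m, hm⟩ := h' w hw s hs hzs
  ⟨m, h.trans hm⟩

variable [CuSemigroup S]

lemma CuSemigroup.zero_wayBelow (x : S) : WayBelow 0 x :=
  fun _ _ _ _ _ => ⟨0, CuSemigroup.zero_le _⟩

/-- Every element is the supremum of an increasing sequence with consecutive terms way below. -/
lemma CuSemigroup.exists_rapidly_increasing (x : S) :
    ∃ z : ℕ → S, Monotone z ∧ (∀ n, WayBelow (z n) (z (n + 1))) ∧ (∀ n, WayBelow (z n) x) ∧
      IsLUB (Set.range z) x := by
  obtain ⟨z, hz, hx⟩ := CuSemigroup.O2 x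
  exact ⟨z, monotone_nat_of_le_succ fun n => (hz n).le, hz,
    fun n => (hz n).trans_le (hx.1 ⟨n + 1, rfl⟩), hx⟩

lemma WayBelow.exists_between {x z : S} (h : WayBelow x z) :
    ∃ y, WayBelow x y ∧ WayBelow y z := by
  obtain ⟨w, hmono, hw, hwz, hlub⟩ := CuSemigroup.exists_rapidly_increasing z
  obtain ⟨m, hm⟩ := h w hmono z hlub le_rfl
  exact ⟨w (m + 1), WayBelow.le_trans hm (hw m), hwz _⟩

lemma WayBelow.exists_add {x y z : S} (h : WayBelow z (x + y)) :
    ∃ x' y', WayBelow x' x ∧ WayBelow y' y ∧ WayBelow z (x' + y') := by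
  obtain ⟨u, hu, hu', hux, hul⟩ := CuSemigroup.exists_rapidly_increasing x
  obtain ⟨v, hv, hv', hvx, hvl⟩ := CuSemigroup.exists_rapidly_increasing y
  obtain ⟨m, hm⟩ := h _ (hu.add hv) _ (CuSemigroup.O4 u v hu hv x y hul hvl) le_rfl
  exact ⟨u (m + 1), v (m + 1), hux _, hvx _,
    WayBelow.le_trans hm (CuSemigroup.O3 (hu' m) (hv' m))⟩

end WayBelow

section Infty

variable [CuSemigroup S]

lemma nsmul_le_infty (n : ℕ) (x : S) : n • x ≤ infty x := (infty_isLUB x).1 ⟨n, rfl⟩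

lemma le_infty_self (x : S) : x ≤ infty x := by simpa using nsmul_le_infty 1 x

lemma infty_add_infty (x : S) : infty x + infty x = infty x := by
  have hm := CuSemigroup.nsmul_mono x
  have h := CuSemigroup.O4 _ _ hm hm _ _ (infty_isLUB x) (infty_isLUB x)
  refine le_antisymm (h.2 ?_) ?_
  · rintro _ ⟨n, rfl⟩
    simpa only [add_nsmul] using nsmul_le_infty (n + n) x
  · simpa using add_le_add_right (CuSemigroup.zero_le (infty x)) (infty x)

lemma add_le_infty {x y z : S} (hx : x ≤ infty z) (hy : y ≤ infty z) : x + y ≤ infty z :=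
  (add_le_add hx hy).trans (infty_add_infty z).le

lemma infty_le_infty_of_le_infty {x y : S} (h : x ≤ infty y) : infty x ≤ infty y := by
  refine (infty_isLUB x).2 ?_
  rintro _ ⟨n, rfl⟩
  induction n with
  | zero => simpa using CuSemigroup.zero_le (infty y)
  | succ n ih =>
    simp only [succ_nsmul]
    exact add_le_infty ih h

lemma infty_mono {x y : S} (h : x ≤ y) : infty x ≤ infty y :=
  infty_le_infty_of_le_infty (h.trans (le_infty_self y))

lemma isLUB_nsmul {z : ℕ → S} (hz : Monotone z) {x : S} (hx : IsLUB (Set.range z) x) (n : ℕ) :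
    IsLUB (Set.range fun k => n • z k) (n • x) := by
  induction n with
  | zero => simp
  | succ n ih =>
    simp only [succ_nsmul]
    exact CuSemigroup.O4 _ _ (fun a b h => nsmul_le_nsmul_right (hz h) n) hz _ _ ih hx

lemma WayBelow.exists_infty {x y : S} (h : WayBelow x (infty y)) :
    ∃ y', WayBelow y' y ∧ WayBelow x (infty y') := by
  obtain ⟨x₁, hx₁, h₁⟩ := h.exists_between
  obtain ⟨x₂, hx₂, h₂⟩ := h₁.exists_between
  obtain ⟨n, hn⟩ := h₂ _ (CuSemigroup.nsmul_mono y) _ (infty_isLUB y) le_rfl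
  obtain ⟨z, hz, -, hzy, hlub⟩ := CuSemigroup.exists_rapidly_increasing y
  obtain ⟨m, hm⟩ := (hx₂.trans_le hn) _ (fun a b h => nsmul_le_nsmul_right (hz h) n) _
    (isLUB_nsmul hz hlub n) le_rfl
  exact ⟨z m, hzy m, hx₁.trans_le (hm.trans (nsmul_le_infty n _))⟩

end Infty

namespace StronglySoft

variable [CuSemigroup S]

lemma add {x y : S} (hx : StronglySoft x) (hy : StronglySoft y) : StronglySoft (x + y) := by
  intro z hz
  obtain ⟨x', y', hx', hy', hz'⟩ := hz.exists_add
  obtain ⟨s, hs, hs'⟩ := hx x' hx'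
  obtain ⟨t, ht, ht'⟩ := hy y' hy'
  have hst : s ≤ s + t := by simpa using add_le_add_right (CuSemigroup.zero_le t) s
  have hts : t ≤ s + t := by simpa using add_le_add_left (CuSemigroup.zero_le s) t
  refine ⟨s + t, WayBelow.le_trans ?_ (CuSemigroup.O3 hs ht), hz'.trans_le ?_⟩
  · rw [add_add_add_comm x' s y' t]
    exact add_le_add_left hz'.le _
  · exact add_le_infty (hs'.le.trans (infty_mono hst)) (ht'.le.trans (infty_mono hts))

lemma zero : StronglySoft (0 : S) := by
  intro x hx
  refine ⟨0, ?_, hx.trans_le (CuSemigroup.zero_le _)⟩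
  simpa using hx

lemma nsmul {x : S} (hx : StronglySoft x) (n : ℕ) : StronglySoft (n • x) := by
  induction n with
  | zero => simpa using zero
  | succ n ih =>
    rw [succ_nsmul]
    exact ih.add hx

/-- A strongly soft element absorbs, up to softness, any element of the ideal it generates. -/
lemma add_of_le_infty {x s : S} (hs : StronglySoft s) (hx : x ≤ infty s) :
    StronglySoft (x + s) := by
  intro z hz
  obtain ⟨x', s₁, hx', hs₁, hz'⟩ := hz.exists_add
  obtain ⟨s₂, hs₂, hxs₂⟩ := (hx'.trans_le hx).exists_infty
  obtain ⟨w, hw, -, hws, hlub⟩ := CuSemigroup.exists_rapidly_increasing s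
  obtain ⟨m₁, hm₁⟩ := hs₁ w hw s hlub le_rfl
  obtain ⟨m₂, hm₂⟩ := hs₂ w hw s hlub le_rfl
  obtain ⟨t, ht, ht'⟩ := hs (w (max m₁ m₂)) (hws _)
  have h₁ : s₁ ≤ w (max m₁ m₂) := hm₁.trans (hw (le_max_left _ _))
  have h₂ : s₂ ≤ w (max m₁ m₂) := hm₂.trans (hw (le_max_right _ _))
  refine ⟨t, WayBelow.le_trans ?_ (CuSemigroup.O3 hx' ht), hz'.trans_le ?_⟩
  · rw [← add_assoc]
    exact add_le_add_left (hz'.le.trans (add_le_add_right h₁ _)) _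
  · refine add_le_infty (hxs₂.le.trans ?_) (h₁.trans ht'.le)
    exact infty_le_infty_of_le_infty (h₂.trans ht'.le)

end StronglySoft

namespace TwoOmegaDivisible

variable [CuSemigroup S]

lemma exists_wayBelow (hdiv : TwoOmegaDivisible S) {x' x : S} (h : WayBelow x' x) :
    ∃ y' y : S, WayBelow y' y ∧ 2 • y ≤ x ∧ x' ≤ infty y' := by
  obtain ⟨x₁, h₁, h₂⟩ := h.exists_between
  obtain ⟨y, hy, hxy⟩ := hdiv x₁ x h₂
  obtain ⟨y', hy', hxy'⟩ := (h₁.trans_le hxy).exists_infty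
  exact ⟨y', y, hy', hy, hxy'.le⟩

lemma exists_halving_sequence (hdiv : TwoOmegaDivisible S) {x' x : S} (h : WayBelow x' x) :
    ∃ e y : ℕ → S, e 0 = x' ∧ y 0 = x ∧ (∀ n, e n ≤ y n) ∧ (∀ n, 2 • y (n + 1) ≤ y n) ∧
      ∀ n, e n ≤ infty (e (n + 1)) := by
  choose f g hfg hg hf using fun p : {p : S × S // WayBelow p.1 p.2} =>
    exists_wayBelow hdiv p.2
  let P : ℕ → {p : S × S // WayBelow p.1 p.2} :=
    fun n => Nat.rec ⟨(x', x), h⟩ (fun _ p => ⟨(f p, g p), hfg p⟩) n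
  exact ⟨fun n => (P n).1.1, fun n => (P n).1.2, rfl, rfl, fun n => (P n).2.le,
    fun n => hg (P n), fun n => hf (P n)⟩

lemma exists_soft_le (hdiv : TwoOmegaDivisible S) {x' x : S} (h : WayBelow x' x) :
    ∃ s : S, StronglySoft s ∧ s ≤ x ∧ x' ≤ infty s := by
  obtain ⟨e, y, rfl, rfl, hey, hy, he⟩ := hdiv.exists_halving_sequence h
  let p : ℕ → S := fun n => ∑ i ∈ Finset.range n, e (i + 1)
  have p_succ (n : ℕ) : p (n + 1) = p n + e (n + 1) := Finset.sum_range_succ _ _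
  have p_mono : Monotone p := monotone_nat_of_le_succ fun n => by
    rw [p_succ]
    simpa using add_le_add_right (CuSemigroup.zero_le (e (n + 1))) (p n)
  have p_add_le (n : ℕ) : p n + y n ≤ y 0 := by
    induction n with
    | zero => simp [p]
    | succ n ih =>
      refine le_trans ?_ ih
      rw [p_succ, add_assoc]
      refine add_le_add_right (le_trans ?_ (hy n)) _
      rw [two_nsmul]
      exact add_le_add_left (hey _) _
  have p_le (n : ℕ) : p n ≤ infty (e n) := by
    induction n with
    | zero => exact CuSemigroup.zero_le _
    | succ n ih =>
      rw [p_succ]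
      exact add_le_infty (ih.trans (infty_le_infty_of_le_infty (he n))) (le_infty_self _)
  obtain ⟨s, hs⟩ := CuSemigroup.O1 p p_mono
  refine ⟨s, ?_, hs.2 ?_, ?_⟩
  · intro z hz
    obtain ⟨z₁, hz₁, hz₂⟩ := hz.exists_between
    obtain ⟨n, hn⟩ := hz₂ p p_mono s hs le_rfl
    obtain ⟨t, ht, hzt⟩ := (hz₁.trans_le
      ((hn.trans (p_le n)).trans (infty_le_infty_of_le_infty (he n)))).exists_infty
    refine ⟨t, (CuSemigroup.O3 (hz₁.trans_le hn) ht).trans_le ?_, hzt⟩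
    rw [← p_succ]
    exact hs.1 ⟨n + 1, rfl⟩
  · rintro _ ⟨n, rfl⟩
    refine le_trans ?_ (p_add_le n)
    simpa using add_le_add_right (CuSemigroup.zero_le (y n)) (p n)
  · refine (he 0).trans (infty_mono (hs.1 ⟨1, ?_⟩))
    simp [p]

lemma exists_soft_nsmul_le (hdiv : TwoOmegaDivisible S) (m : ℕ) {x' x : S}
    (h : WayBelow x' x) : ∃ s : S, StronglySoft s ∧ 2 ^ m • s ≤ x ∧ x' ≤ infty s := by
  induction m generalizing x' x with
  | zero => simpa using hdiv.exists_soft_le h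
  | succ m ih =>
    obtain ⟨y', y, hy', hy, hxy⟩ := hdiv.exists_wayBelow h
    obtain ⟨s, hs, hsy, hys⟩ := ih hy'
    refine ⟨s, hs, le_trans ?_ hy, hxy.trans (infty_le_infty_of_le_infty hys)⟩
    rw [pow_succ, mul_nsmul]
    exact nsmul_le_nsmul_right hsy 2

lemma exists_soft_between (hdiv : TwoOmegaDivisible S) {v u : S} (hu : StronglySoft u)
    (h : WayBelow v u) : ∃ w : S, StronglySoft w ∧ v ≤ w ∧ WayBelow w u := by
  obtain ⟨t, ht, hvt⟩ := hu v h
  obtain ⟨t', ht', hvt'⟩ := hvt.exists_infty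
  obtain ⟨s, hs, hst, hts⟩ := hdiv.exists_soft_le ht'
  refine ⟨v + s, hs.add_of_le_infty (hvt'.le.trans (infty_le_infty_of_le_infty hts)), ?_,
    WayBelow.le_trans (add_le_add_right hst v) ht⟩
  simpa using add_le_add_right (CuSemigroup.zero_le s) v

/-- Strongly soft elements are suprema of increasing sequences of strongly soft elements
way below them. -/
lemma exists_soft_sequence (hdiv : TwoOmegaDivisible S) {u : S} (hu : StronglySoft u) :
    ∃ w : ℕ → S, Monotone w ∧ (∀ n, StronglySoft (w n)) ∧ (∀ n, WayBelow (w n) u) ∧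
      IsLUB (Set.range w) u := by
  obtain ⟨z, hz, -, hzu, hlub⟩ := CuSemigroup.exists_rapidly_increasing u
  choose w hw hzw hwu using fun n => hdiv.exists_soft_between hu (hzu n)
  choose g hg using fun n => hwu n z hz u hlub le_rfl
  let k : ℕ → ℕ := fun n => Nat.rec 0 (fun _ i => g i + i + 1) n
  have k_succ (n : ℕ) : k (n + 1) = g (k n) + k n + 1 := rfl
  have le_k (n : ℕ) : n ≤ k n := by
    induction n with
    | zero => exact Nat.zero_le _
    | succ n ih => rw [k_succ]; omega
  refine ⟨fun n => w (k n), monotone_nat_of_le_succ fun n => ?_, fun n => hw _, fun n => hwu _,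
    ?_, fun b hb => hlub.2 ?_⟩
  · exact ((hg (k n)).trans (hz (by rw [k_succ]; omega))).trans (hzw _)
  · rintro _ ⟨n, rfl⟩
    exact (hwu _).le
  · rintro _ ⟨n, rfl⟩
    exact (hz (le_k n)).trans ((hzw _).trans (hb ⟨n, rfl⟩))

/-- Any element way below `x` is dominated by the sum of two strongly soft elements below `x`,
one of which can be chosen arbitrarily small relative to `x`. -/
lemma exists_soft_add_ge (hdiv : TwoOmegaDivisible S) (hO5 : SatisfiesO5 S)
    (hO6 : SatisfiesO6 S) (m : ℕ) {x' x : S} (h : WayBelow x' x) :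
    ∃ a b : S, StronglySoft a ∧ StronglySoft b ∧ 2 ^ m • a ≤ x ∧ b ≤ x ∧ x' ≤ a + b := by
  obtain ⟨x₁, h₁, h₁'⟩ := h.exists_between
  obtain ⟨x₂, h₂, h₂'⟩ := h₁'.exists_between
  obtain ⟨a, ha, hax, hxa⟩ := hdiv.exists_soft_nsmul_le m h₂'
  obtain ⟨a₁, ha₁, hxa₁⟩ := (h₂.trans_le hxa).exists_infty
  obtain ⟨a', ha', haa', haw⟩ := hdiv.exists_soft_between ha ha₁
  have hle : a ≤ x := by
    refine le_trans ?_ hax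
    simpa using CuSemigroup.nsmul_mono a (Nat.one_le_two_pow (n := m))
  obtain ⟨c, -, hc, hxc⟩ := hO5 a' a 0 0 x haw (CuSemigroup.zero_wayBelow 0) (by simpa using hle)
  obtain ⟨v, w, -, hva, hwx, hwc, hx'⟩ := hO6 x' x₁ a c h₁ (h₁'.trans_le hxc)
  refine ⟨a, w + a', ha, ha'.add_of_le_infty ?_, hax, ?_, ?_⟩
  · exact hwx.trans (hxa₁.le.trans (infty_mono haa'))
  · rw [add_comm]
    exact (add_le_add_right hwc _).trans hc
  · refine hx'.trans (add_le_add hva ?_)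
    simpa using add_le_add_right (CuSemigroup.zero_le a') w

end TwoOmegaDivisible

lemma ENNReal.le_of_forall_le_add_of_two_pow_mul_le {a b : ENNReal}
    (h : ∀ m : ℕ, ∃ c : ENNReal, 2 ^ m * c ≤ b ∧ a ≤ b + c) : a ≤ b := by
  by_cases hb : b = ⊤
  · simp [hb]
  have hlim : Filter.Tendsto (fun m : ℕ => b + (2⁻¹ : ENNReal) ^ m * b) Filter.atTop
      (nhds (b + 0 * b)) :=
    tendsto_const_nhds.add (ENNReal.Tendsto.mul_const
      (ENNReal.tendsto_pow_atTop_nhds_zero_of_lt_one (by simp)) (Or.inr hb))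
  rw [zero_mul, add_zero] at hlim
  refine ge_of_tendsto' hlim fun m => ?_
  obtain ⟨c, hc, hac⟩ := h m
  refine hac.trans (add_le_add_right ?_ _)
  rw [← ENNReal.inv_pow, mul_comm, ← div_eq_mul_inv]
  exact (ENNReal.le_div_iff_mul_le (by simp) (by simp)).2 (by rwa [mul_comm])

lemma IsFunctionalOn.map_nsmul [CuSemigroup S] {f : S → ENNReal}
    (hf : IsFunctionalOn {x : S | StronglySoft x} f) {a : S} (ha : StronglySoft a) (n : ℕ) :
    f (n • a) = n * f a := by
  induction n with
  | zero => simp [hf.1]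
  | succ n ih =>
    rw [succ_nsmul, hf.2.1 _ (ha.nsmul n) _ ha, ih]
    push_cast
    ring

lemma CuFunctional.map_nsmul [CuSemigroup S] (lam : CuFunctional S) (a : S) (n : ℕ) :
    lam.toFun (n • a) = n * lam.toFun a := by
  induction n with
  | zero => simp [lam.map_zero]
  | succ n ih =>
    rw [succ_nsmul, lam.map_add, ih]
    push_cast
    ring

lemma CuFunctional.le_of_eq_on_soft [CuSemigroup S] (hdiv : TwoOmegaDivisible S)
    (hO5 : SatisfiesO5 S) (hO6 : SatisfiesO6 S) {lam mu : CuFunctional S}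
    (h : ∀ x : S, StronglySoft x → lam.toFun x = mu.toFun x) (x : S) :
    lam.toFun x ≤ mu.toFun x := by
  obtain ⟨z, hz, -, hzx, hlub⟩ := CuSemigroup.exists_rapidly_increasing x
  rw [lam.map_sup z hz x hlub]
  refine iSup_le fun n => ENNReal.le_of_forall_le_add_of_two_pow_mul_le fun m => ?_
  obtain ⟨a, b, ha, hb, hax, hbx, hab⟩ := hdiv.exists_soft_add_ge hO5 hO6 m (hzx n)
  refine ⟨mu.toFun a, ?_, (lam.mono _ _ hab).trans ?_⟩
  · simpa [mu.map_nsmul] using mu.mono _ _ hax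
  · rw [lam.map_add, h a ha, h b hb, add_comm]
    exact add_le_add_left (mu.mono _ _ hbx) _

/-- The extension of a function on the strongly soft elements by suprema from below. -/
noncomputable def softSup [CuSemigroup S] (f : S → ENNReal) (x : S) : ENNReal :=
  ⨆ u : {u : S // StronglySoft u ∧ u ≤ x}, f u

section SoftSup

variable [CuSemigroup S] {f : S → ENNReal}

lemma le_softSup {u x : S} (hu : StronglySoft u) (h : u ≤ x) : f u ≤ softSup f x :=
  le_iSup (fun u : {u : S // StronglySoft u ∧ u ≤ x} => f u) ⟨u, hu, h⟩

lemma softSup_mono {x y : S} (h : x ≤ y) : softSup f x ≤ softSup f y :=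
  iSup_le fun u => le_softSup u.2.1 (u.2.2.trans h)

lemma softSup_eq (hf : IsFunctionalOn {x : S | StronglySoft x} f) {x : S}
    (hx : StronglySoft x) : softSup f x = f x :=
  le_antisymm (iSup_le fun u => hf.2.2.1 _ u.2.1 _ hx u.2.2) (le_softSup hx le_rfl)

lemma IsFunctionalOn.exists_soft_sequence (hf : IsFunctionalOn {x : S | StronglySoft x} f)
    (hdiv : TwoOmegaDivisible S) {u : S} (hu : StronglySoft u) :
    ∃ w : ℕ → S, (∀ n, StronglySoft (w n)) ∧ (∀ n, WayBelow (w n) u) ∧ f u = ⨆ n, f (w n) := by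
  obtain ⟨w, hw, hws, hwu, hlub⟩ := hdiv.exists_soft_sequence hu
  exact ⟨w, hws, hwu, hf.2.2.2 w hw hws u ⟨hu, hlub.1, fun b _ hb => hlub.2 hb⟩⟩

lemma softSup_of_isLUB (hf : IsFunctionalOn {x : S | StronglySoft x} f)
    (hdiv : TwoOmegaDivisible S) {z : ℕ → S} (hz : Monotone z) {s : S}
    (hs : IsLUB (Set.range z) s) : softSup f s = ⨆ n, softSup f (z n) := by
  refine le_antisymm (iSup_le fun ⟨u, hu, hus⟩ => ?_)
    (iSup_le fun n => softSup_mono (hs.1 ⟨n, rfl⟩))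
  obtain ⟨w, hws, hwu, hfu⟩ := hf.exists_soft_sequence hdiv hu
  simp only [hfu]
  refine iSup_le fun n => ?_
  obtain ⟨m, hm⟩ := hwu n z hz s hs hus
  exact (le_softSup (hws n) hm).trans (le_iSup (fun n => softSup f (z n)) m)

lemma softSup_add (hf : IsFunctionalOn {x : S | StronglySoft x} f)
    (hdiv : TwoOmegaDivisible S) (hO5 : SatisfiesO5 S) (hO6 : SatisfiesO6 S) (x y : S) :
    softSup f (x + y) = softSup f x + softSup f y := by
  refine le_antisymm (iSup_le fun ⟨u, hu, hus⟩ => ?_) ?_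
  · obtain ⟨w, hws, hwu, hfu⟩ := hf.exists_soft_sequence hdiv hu
    simp only [hfu]
    refine iSup_le fun n => ENNReal.le_of_forall_le_add_of_two_pow_mul_le fun m => ?_
    obtain ⟨x', y', hx', hy', hxy⟩ := ((hwu n).trans_le hus).exists_add
    obtain ⟨a, b, ha, hb, hax, hbx, hab⟩ := hdiv.exists_soft_add_ge hO5 hO6 m hx'
    obtain ⟨c, d, hc, hd, hcy, hdy, hcd⟩ := hdiv.exists_soft_add_ge hO5 hO6 m hy'
    refine ⟨f a + f c, ?_, ?_⟩
    · rw [mul_add]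
      refine add_le_add ?_ ?_
      · simpa [hf.map_nsmul ha] using le_softSup (f := f) (ha.nsmul _) hax
      · simpa [hf.map_nsmul hc] using le_softSup (f := f) (hc.nsmul _) hcy
    · calc f (w n) ≤ f ((a + b) + (c + d)) :=
            hf.2.2.1 _ (hws n) _ ((ha.add hb).add (hc.add hd)) (hxy.le.trans (add_le_add hab hcd))
        _ = (f b + f d) + (f a + f c) := by
            rw [hf.2.1 _ (ha.add hb) _ (hc.add hd), hf.2.1 _ ha _ hb, hf.2.1 _ hc _ hd]
            ring
        _ ≤ _ := by
            gcongr
            · exact le_softSup hb hbx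
            · exact le_softSup hd hdy
  · have : Nonempty {u : S // StronglySoft u ∧ u ≤ x} :=
      ⟨⟨0, StronglySoft.zero, CuSemigroup.zero_le x⟩⟩
    have : Nonempty {u : S // StronglySoft u ∧ u ≤ y} :=
      ⟨⟨0, StronglySoft.zero, CuSemigroup.zero_le y⟩⟩
    refine ENNReal.iSup_add_iSup_le fun u v => ?_
    rw [← hf.2.1 _ u.2.1 _ v.2.1]
    exact le_softSup (u.2.1.add v.2.1) (add_le_add u.2.2 v.2.2)

end SoftSup

/-- In a (2,ω)-divisible Cu-semigroup satisfying (O5)-(O7), the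
restriction map `ι* : F(S) → F(S_soft)` is a bijection: functionals on `S` are
determined by their restriction to the strongly soft elements, and every
functional on the soft part extends to a functional on `S`. -/
theorem restriction_to_soft_bijective {S : Type*} [CuSemigroup S]
    (hdiv : TwoOmegaDivisible S)
    (hO5 : SatisfiesO5 S) (hO6 : SatisfiesO6 S) (hO7 : SatisfiesO7 S) :
    (∀ lam mu : CuFunctional S,
      (∀ x : S, StronglySoft x → lam.toFun x = mu.toFun x) → lam = mu) ∧
    (∀ f : S → ENNReal, IsFunctionalOn {x : S | StronglySoft x} f →
      ∃ lam : CuFunctional S, ∀ x : S, StronglySoft x → lam.toFun x = f x) := by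
  refine ⟨fun lam mu h => ?_, fun f hf => ⟨⟨softSup f, ?_, softSup_add hf hdiv hO5 hO6,
    fun x y => softSup_mono, fun z hz s hs => softSup_of_isLUB hf hdiv hz hs⟩,
    fun x hx => softSup_eq hf hx⟩⟩
  · have heq : lam.toFun = mu.toFun := funext fun x => le_antisymm
      (CuFunctional.le_of_eq_on_soft hdiv hO5 hO6 h x)
      (CuFunctional.le_of_eq_on_soft hdiv hO5 hO6 (fun y hy => (h y hy).symm) x)
    cases lam
    cases mu
    congr
  · rw [softSup_eq hf StronglySoft.zero, hf.1]
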